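/- Let M_n be the (n+1)×(n+1) matrix with entries M_{n,jk} = [√(2k+1)/C(n,j)]·Σ_{i=max(0,j+k−n)}^{min(j,k)} (−1)^{k+i} C(k,i)² C(n−k, j−i), which converts shifted Legendre coefficients to degree-n Bernstein coefficients. Then M_n is invertible and its inverse has entries M^{-1}_{n,jk} = [√(2j+1)/(n+j+1)]·C(n,k)·Σ_{i=0}^{j} (−1)^{i+j} C(j,i)² / C(n+j, k+i), for 0 ≤ j,k ≤ n. Equivalently, the degree-n Bernstein basis polynomial b^n_k(t) has shifted Legendre expansion b^n_k(t) = Σ_{j=0}^n M^{-1}_{n,jk} L_j(t). -/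

import Mathlib

/-- The Bernstein basis polynomial b^n_k(t) = C(n,k)(1−t)^{n−k} t^k on [0,1]. -/
noncomputable def bern (n k : ℕ) (t : ℝ) : ℝ :=
  (n.choose k : ℝ) * (1 - t) ^ (n - k) * t ^ k

/-- The orthonormal shifted Legendre polynomial on [0,1]:
L_k(t) = √(2k+1)·Σ_{i=0}^k (−1)^{k+i} C(k,i)² (1−t)^{k−i} t^i. -/
noncomputable def legendreL (k : ℕ) (t : ℝ) : ℝ :=
  Real.sqrt (2 * k + 1) * ∑ i ∈ Finset.range (k + 1),
    (-1 : ℝ) ^ (k + i) * (k.choose i : ℝ) ^ 2 * (1 - t) ^ (k - i) * t ^ i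

/-- Entry (j,k) of the matrix M_n converting shifted Legendre coefficients to degree-n
Bernstein coefficients:
M_{n,jk} = [√(2k+1)/C(n,j)]·Σ_{i=max(0,j+k−n)}^{min(j,k)} (−1)^{k+i} C(k,i)² C(n−k,j−i). -/
noncomputable def Mentry (n j k : ℕ) : ℝ :=
  (Real.sqrt (2 * k + 1) / (n.choose j : ℝ)) *
    ∑ i ∈ Finset.Icc (max 0 (j + k - n)) (min j k),
      (-1 : ℝ) ^ (k + i) * (k.choose i : ℝ) ^ 2 * ((n - k).choose (j - i) : ℝ)

/-- Entry (j,k) of the inverse matrix M_n⁻¹: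
M⁻¹_{n,jk} = [√(2j+1)/(n+j+1)]·C(n,k)·Σ_{i=0}^{j} (−1)^{i+j} C(j,i)² / C(n+j,k+i). -/
noncomputable def Minventry (n j k : ℕ) : ℝ :=
  (Real.sqrt (2 * j + 1) / ((n : ℝ) + (j : ℝ) + 1)) * (n.choose k : ℝ) *
    ∑ i ∈ Finset.range (j + 1),
      (-1 : ℝ) ^ (i + j) * (j.choose i : ℝ) ^ 2 / (((n + j).choose (k + i) : ℕ) : ℝ)

open Polynomial Finset Nat

/-- The functional `p ↦ ∫₀¹ p(t) dt` on real polynomials. -/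
noncomputable def unitIntegral : ℝ[X] →ₗ[ℝ] ℝ :=
  Polynomial.lsum fun i => ((1 : ℝ) / ((i : ℝ) + 1)) • LinearMap.id

lemma unitIntegral_X_pow (b : ℕ) : unitIntegral (X ^ b) = 1 / ((b : ℝ) + 1) := by
  rw [unitIntegral, Polynomial.lsum_apply, Polynomial.X_pow_eq_monomial,
    Polynomial.sum_monomial_index] <;> simp

/-- The beta integral at natural arguments. -/
lemma unitIntegral_one_sub_X_pow_mul_X_pow (a b : ℕ) :
    unitIntegral ((1 - X) ^ a * X ^ b) = (a ! : ℝ) * b ! / (a + b + 1)! := by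
  induction a generalizing b with
  | zero =>
    simp only [pow_zero, one_mul, unitIntegral_X_pow, zero_add, factorial_zero, cast_one,
      factorial_succ]
    push_cast
    have : (b ! : ℝ) ≠ 0 := by positivity
    field_simp
  | succ a ih =>
    have h : ((1 - X) ^ (a + 1) * X ^ b : ℝ[X]) =
        (1 - X) ^ a * X ^ b - (1 - X) ^ a * X ^ (b + 1) := by ring
    rw [h, map_sub, ih, ih, show a + 1 + b + 1 = a + b + 1 + 1 by ring,
      show a + (b + 1) + 1 = a + b + 1 + 1 by ring, factorial_succ (a + b + 1), factorial_succ a,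
      factorial_succ b]
    have : ((a + b + 1)! : ℝ) ≠ 0 := by positivity
    push_cast
    field_simp
    ring

/-- The shifted Legendre polynomial normalised to take the value `1` at `1`. -/
noncomputable def legendrePoly (k : ℕ) : ℝ[X] :=
  ∑ i ∈ range (k + 1), ((-1 : ℝ) ^ (k + i) * (k.choose i : ℝ) ^ 2) • ((1 - X) ^ (k - i) * X ^ i)

lemma legendreL_eq_eval (k : ℕ) (t : ℝ) :
    legendreL k t = Real.sqrt (2 * k + 1) * (legendrePoly k).eval t := by
  simp [legendreL, legendrePoly, eval_finsetSum, mul_assoc]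

lemma natDegree_one_sub_X_pow_mul_X_pow_le (a b : ℕ) :
    ((1 - X) ^ a * X ^ b : ℝ[X]).natDegree ≤ a + b := by
  compute_degree

lemma coeff_one_sub_X_pow_mul_X_pow (a b : ℕ) :
    ((1 - X) ^ a * X ^ b : ℝ[X]).coeff (a + b) = (-1) ^ a := by
  rw [coeff_mul_X_pow]
  have h : (1 - X : ℝ[X]).natDegree ≤ 1 := by compute_degree
  simpa [coeff_one] using coeff_pow_of_natDegree_le (m := a) h

lemma natDegree_legendrePoly_le (k : ℕ) : (legendrePoly k).natDegree ≤ k := by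
  refine natDegree_sum_le_of_forall_le _ _ fun i hi => (natDegree_smul_le _ _).trans ?_
  have := natDegree_one_sub_X_pow_mul_X_pow_le (k - i) i
  rw [mem_range] at hi
  omega

lemma coeff_legendrePoly (k : ℕ) : (legendrePoly k).coeff k = ((2 * k).choose k : ℝ) := by
  rw [← Nat.sum_range_choose_sq, legendrePoly, finsetSum_coeff]
  push_cast
  refine sum_congr rfl fun i hi => ?_
  obtain ⟨d, rfl⟩ := Nat.exists_eq_add_of_le' (mem_range_succ_iff.mp hi)
  rw [coeff_smul, Nat.add_sub_cancel, coeff_one_sub_X_pow_mul_X_pow, smul_eq_mul,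
    mul_right_comm, ← pow_add, Even.neg_one_pow ⟨d + i, by ring⟩, one_mul]

lemma fwdDiff_iter_eval_one (k : ℕ) (p : ℝ[X]) :
    (fwdDiff (1 : ℝ))^[k] p.eval 1 =
      ∑ i ∈ range (k + 1), (-1 : ℝ) ^ (k + i) * k.choose i * p.eval ((i : ℝ) + 1) := by
  rw [fwdDiff_iter_eq_sum_shift]
  refine sum_congr rfl fun i hi => ?_
  obtain ⟨d, rfl⟩ := Nat.exists_eq_add_of_le' (mem_range_succ_iff.mp hi)
  have : (-1 : ℝ) ^ (d + i + i) = (-1) ^ d := by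
    rw [add_assoc, pow_add, Even.neg_one_pow ⟨i, rfl⟩, mul_one]
  simp [this, add_comm (1 : ℝ)]

lemma unitIntegral_legendrePoly_mul_X_pow_eq_fwdDiff (k m : ℕ) :
    unitIntegral (legendrePoly k * X ^ m) =
      (k ! : ℝ) / (k + m + 1)! * (fwdDiff (1 : ℝ))^[k] (ascPochhammer ℝ m).eval 1 := by
  rw [fwdDiff_iter_eval_one, legendrePoly, sum_mul, map_sum, mul_sum]
  refine sum_congr rfl fun i hi => ?_
  have hik : i ≤ k := mem_range_succ_iff.mp hi
  rw [smul_mul_assoc, map_smul, mul_assoc, ← pow_add, unitIntegral_one_sub_X_pow_mul_X_pow,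
    ← factorial_mul_ascPochhammer, ← Nat.choose_mul_factorial_mul_factorial hik,
    show k - i + (i + m) + 1 = k + m + 1 by omega, smul_eq_mul]
  push_cast
  ring

lemma unitIntegral_legendrePoly_mul_X_pow_of_lt {k m : ℕ} (h : m < k) :
    unitIntegral (legendrePoly k * X ^ m) = 0 := by
  rw [unitIntegral_legendrePoly_mul_X_pow_eq_fwdDiff,
    fwdDiff_iter_eq_zero_of_degree_lt (by rwa [ascPochhammer_natDegree]), Pi.zero_apply, mul_zero]

lemma unitIntegral_legendrePoly_mul_X_pow_self (k : ℕ) :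
    unitIntegral (legendrePoly k * X ^ k) = (k ! : ℝ) * k ! / (2 * k + 1)! := by
  have h := fwdDiff_iter_degree_eq_factorial (ascPochhammer ℝ k)
  rw [ascPochhammer_natDegree, (monic_ascPochhammer ℝ k).leadingCoeff] at h
  rw [unitIntegral_legendrePoly_mul_X_pow_eq_fwdDiff, h, ← two_mul]
  simp
  ring

lemma unitIntegral_legendrePoly_mul {k : ℕ} {q : ℝ[X]} (hq : q.natDegree ≤ k) :
    unitIntegral (legendrePoly k * q) = q.coeff k * ((k ! : ℝ) * k ! / (2 * k + 1)!) := by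
  conv_lhs => rw [q.as_sum_range_C_mul_X_pow' (Nat.lt_succ_of_le hq)]
  simp_rw [mul_sum, map_sum, ← smul_eq_C_mul, mul_smul_comm, map_smul, smul_eq_mul]
  rw [sum_range_succ, sum_eq_zero, zero_add, unitIntegral_legendrePoly_mul_X_pow_self]
  intro i hi
  rw [unitIntegral_legendrePoly_mul_X_pow_of_lt (mem_range.mp hi), mul_zero]

lemma unitIntegral_legendrePoly_mul_legendrePoly_of_lt {j k : ℕ} (h : j < k) :
    unitIntegral (legendrePoly k * legendrePoly j) = 0 := by
  have hj := natDegree_legendrePoly_le j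
  rw [unitIntegral_legendrePoly_mul (hj.trans h.le),
    coeff_eq_zero_of_natDegree_lt (hj.trans_lt h), zero_mul]

lemma unitIntegral_legendrePoly_mul_self (k : ℕ) :
    unitIntegral (legendrePoly k * legendrePoly k) = 1 / (2 * (k : ℝ) + 1) := by
  rw [unitIntegral_legendrePoly_mul (natDegree_legendrePoly_le k), coeff_legendrePoly,
    factorial_succ, ← Nat.choose_mul_factorial_mul_factorial (show k ≤ 2 * k by omega),
    show 2 * k - k = k by omega]
  have h₁ : (k ! : ℝ) ≠ 0 := by positivity
  have h₂ : ((2 * k).choose k : ℝ) ≠ 0 := by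
    exact_mod_cast (Nat.choose_pos (show k ≤ 2 * k by omega)).ne'
  push_cast
  field_simp

/-- Orthonormality of the shifted Legendre polynomials. -/
lemma sqrt_mul_sqrt_mul_unitIntegral (j k : ℕ) :
    Real.sqrt (2 * j + 1) * Real.sqrt (2 * k + 1) *
      unitIntegral (legendrePoly j * legendrePoly k) = if j = k then 1 else 0 := by
  rcases lt_trichotomy j k with h | rfl | h
  · rw [mul_comm (legendrePoly j), unitIntegral_legendrePoly_mul_legendrePoly_of_lt h,
      mul_zero, if_neg h.ne]
  · rw [Real.mul_self_sqrt (by positivity), unitIntegral_legendrePoly_mul_self, if_pos rfl]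
    field_simp
  · rw [unitIntegral_legendrePoly_mul_legendrePoly_of_lt h, mul_zero, if_neg h.ne']

/-- Degree elevation of a single Bernstein monomial. -/
lemma sum_choose_smul_one_sub_X_pow_mul_X_pow {n k i : ℕ} (hk : k ≤ n) (hi : i ≤ k) :
    ∑ j ∈ range (n + 1), (if i ≤ j then ((n - k).choose (j - i) : ℝ) else 0) •
      ((1 - X) ^ (n - j) * X ^ j : ℝ[X]) = (1 - X) ^ (k - i) * X ^ i := by
  have hsub : Ico i (n - k + 1 + i) ⊆ range (n + 1) := fun j hj => by
    rw [mem_Ico] at hj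
    rw [mem_range]
    omega
  rw [← sum_subset hsub, sum_Ico_eq_sum_range, Nat.add_sub_cancel]
  · have h := add_pow (X : ℝ[X]) (1 - X) (n - k)
    rw [add_sub_cancel, one_pow] at h
    have h' := congrArg (((1 - X) ^ (k - i) * X ^ i) * ·) h
    simp only [mul_one, mul_sum] at h'
    rw [h']
    refine sum_congr rfl fun m hm => ?_
    have hm' : m ≤ n - k := mem_range_succ_iff.mp hm
    rw [if_pos (Nat.le_add_right i m), Nat.add_sub_cancel_left, smul_eq_C_mul, C_eq_natCast,
      show n - (i + m) = (k - i) + (n - k - m) by omega]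
    ring
  · intro j _ hj
    rw [mem_Ico] at hj
    split_ifs with hij
    · rw [Nat.choose_eq_zero_of_lt (by omega), cast_zero, zero_smul]
    · rw [zero_smul]

lemma Mentry_eq_sum_range {n k : ℕ} (j : ℕ) (hk : k ≤ n) :
    Mentry n j k = (Real.sqrt (2 * k + 1) / (n.choose j : ℝ)) *
      ∑ i ∈ range (k + 1), (-1 : ℝ) ^ (k + i) * (k.choose i : ℝ) ^ 2 *
        (if i ≤ j then ((n - k).choose (j - i) : ℝ) else 0) := by
  rw [Mentry]
  congr 1
  have hsub : Icc (max 0 (j + k - n)) (min j k) ⊆ range (k + 1) := fun i hi => by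
    rw [mem_Icc] at hi
    rw [mem_range]
    omega
  rw [← sum_subset hsub]
  · refine sum_congr rfl fun i hi => ?_
    rw [mem_Icc] at hi
    rw [if_pos (by omega)]
  · intro i hi hi'
    rw [mem_Icc] at hi'
    rw [mem_range] at hi
    split_ifs with hij
    · rw [Nat.choose_eq_zero_of_lt (show n - k < j - i by omega), cast_zero, mul_zero]
    · rw [mul_zero]

/-- The columns of `M_n` are the Bernstein coefficients of the shifted Legendre polynomials. -/
lemma sum_Mentry_smul {n k : ℕ} (hk : k ≤ n) :
    ∑ j ∈ range (n + 1), Mentry n j k •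
      ((n.choose j : ℝ) • ((1 - X) ^ (n - j) * X ^ j : ℝ[X])) =
      Real.sqrt (2 * k + 1) • legendrePoly k := by
  calc
    _ = ∑ j ∈ range (n + 1), Real.sqrt (2 * k + 1) • ∑ i ∈ range (k + 1),
          ((-1 : ℝ) ^ (k + i) * (k.choose i : ℝ) ^ 2) •
            ((if i ≤ j then ((n - k).choose (j - i) : ℝ) else 0) •
              ((1 - X) ^ (n - j) * X ^ j : ℝ[X])) := by
      refine sum_congr rfl fun j hj => ?_
      have hc : (n.choose j : ℝ) ≠ 0 := by
        exact_mod_cast (Nat.choose_pos (mem_range_succ_iff.mp hj)).ne'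
      simp_rw [smul_smul _ _ ((1 - X) ^ (n - j) * X ^ j : ℝ[X])]
      rw [← sum_smul, smul_smul, Mentry_eq_sum_range j hk]
      congr 1
      field_simp
    _ = _ := by
      rw [← smul_sum, sum_comm, legendrePoly]
      congr 1
      refine sum_congr rfl fun i hi => ?_
      rw [← smul_sum, sum_choose_smul_one_sub_X_pow_mul_X_pow hk (mem_range_succ_iff.mp hi)]

/-- The inverse matrix collects the Legendre coefficients of the Bernstein polynomials. -/
lemma Minventry_eq_unitIntegral {n k : ℕ} (j : ℕ) (hk : k ≤ n) :
    Minventry n j k = Real.sqrt (2 * j + 1) * unitIntegral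
      (legendrePoly j * ((n.choose k : ℝ) • ((1 - X) ^ (n - k) * X ^ k))) := by
  rw [Minventry, legendrePoly, mul_smul_comm, map_smul, sum_mul, map_sum, smul_eq_mul, mul_sum,
    mul_sum, mul_sum]
  refine sum_congr rfl fun i hi => ?_
  have hij : i ≤ j := mem_range_succ_iff.mp hi
  have hle : k + i ≤ n + j := by omega
  have hprod : ((1 - X) ^ (j - i) * X ^ i * ((1 - X) ^ (n - k) * X ^ k) : ℝ[X]) =
      (1 - X) ^ (n + j - (k + i)) * X ^ (k + i) := by
    rw [show n + j - (k + i) = (j - i) + (n - k) by omega]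
    ring
  rw [smul_mul_assoc, map_smul, hprod, unitIntegral_one_sub_X_pow_mul_X_pow,
    Nat.sub_add_cancel hle, factorial_succ, ← Nat.choose_mul_factorial_mul_factorial hle,
    smul_eq_mul, add_comm i j]
  have hc : ((n + j).choose (k + i) : ℝ) ≠ 0 := by exact_mod_cast (Nat.choose_pos hle).ne'
  have h₁ : ((k + i)! : ℝ) ≠ 0 := by positivity
  have h₂ : ((n + j - (k + i))! : ℝ) ≠ 0 := by positivity
  have h₃ : (n : ℝ) + j + 1 ≠ 0 := by positivity
  push_cast
  field_simp

lemma sum_Minventry_mul_Mentry {n k : ℕ} (j : ℕ) (hk : k ≤ n) :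
    ∑ l ∈ range (n + 1), Minventry n j l * Mentry n l k = if j = k then 1 else 0 := by
  rw [← sqrt_mul_sqrt_mul_unitIntegral, mul_assoc, ← smul_eq_mul (Real.sqrt (2 * k + 1)),
    ← map_smul, ← mul_smul_comm, ← sum_Mentry_smul hk, mul_sum, map_sum, mul_sum]
  refine sum_congr rfl fun l hl => ?_
  rw [Minventry_eq_unitIntegral j (mem_range_succ_iff.mp hl), mul_smul_comm (Mentry n l k),
    map_smul, smul_eq_mul]
  ring

lemma legendreL_eq_sum_Mentry {n k : ℕ} (hk : k ≤ n) (t : ℝ) :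
    legendreL k t = ∑ l ∈ range (n + 1), Mentry n l k * bern n l t := by
  have h := congrArg (Polynomial.eval t) (sum_Mentry_smul hk)
  rw [eval_smul, smul_eq_mul, ← legendreL_eq_eval] at h
  rw [← h, eval_finsetSum]
  simp [bern, mul_assoc]

/-- The Legendre-to-Bernstein matrix M_n is invertible, with inverse given by the explicit
entries M⁻¹_{n,jk}; equivalently, b^n_k(t) = Σ_{j=0}^n M⁻¹_{n,jk} L_j(t). -/
theorem stmt15 (n : ℕ) :
    (Matrix.of fun j k : Fin (n + 1) => Mentry n j k) *
        (Matrix.of fun j k : Fin (n + 1) => Minventry n j k) = 1 ∧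
    (Matrix.of fun j k : Fin (n + 1) => Minventry n j k) *
        (Matrix.of fun j k : Fin (n + 1) => Mentry n j k) = 1 ∧
    (∀ k, k ≤ n → ∀ t : ℝ,
        bern n k t = ∑ j ∈ Finset.range (n + 1), Minventry n j k * legendreL j t) := by
  have hinv : (Matrix.of fun j k : Fin (n + 1) => Minventry n j k) *
      (Matrix.of fun j k : Fin (n + 1) => Mentry n j k) = 1 := by
    ext j k
    rw [Matrix.mul_apply, Matrix.one_apply]
    simp only [Matrix.of_apply, Fin.ext_iff]
    rw [← sum_Minventry_mul_Mentry j (Nat.le_of_lt_succ k.isLt),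
      ← Fin.sum_univ_eq_sum_range (fun l => Minventry n j l * Mentry n l k)]
  have hinv' := mul_eq_one_comm.mp hinv
  refine ⟨hinv', hinv, fun k hk t => ?_⟩
  have hsum : ∀ l ∈ range (n + 1), ∑ j ∈ range (n + 1), Mentry n l j * Minventry n j k =
      if l = k then 1 else 0 := fun l hl => by
    have h := congrFun₂ hinv' ⟨l, mem_range.mp hl⟩ ⟨k, Nat.lt_succ_of_le hk⟩
    rw [Matrix.mul_apply, Matrix.one_apply] at h
    simp only [Matrix.of_apply, Fin.ext_iff] at h
    rw [← h, ← Fin.sum_univ_eq_sum_range (fun j => Mentry n l j * Minventry n j k)]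
  symm
  calc
    _ = ∑ j ∈ range (n + 1), ∑ l ∈ range (n + 1),
          Mentry n l j * Minventry n j k * bern n l t := by
      refine sum_congr rfl fun j hj => ?_
      rw [legendreL_eq_sum_Mentry (mem_range_succ_iff.mp hj), mul_sum]
      exact sum_congr rfl fun l _ => by ring
    _ = ∑ l ∈ range (n + 1), (if l = k then 1 else 0) * bern n l t := by
      rw [sum_comm]
      exact sum_congr rfl fun l hl => by rw [← sum_mul, hsum l hl]
    _ = bern n k t := by
      simp [Nat.lt_succ_of_le hk]
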